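/- arXiv:1605.08005 — 3 statements merged into one kernel-verified Lean document; each statement's English description precedes it below -/
import Mathlib

section
/- Let K be a field, and let W, A, B be finite-dimensional K-vector spaces. Let j : W → Hom_K(A,B) be a K-linear map, let X ⊆ W be a subset, and let k ≥ 1 be a natural number with rank(j(p)) ≤ k for every p ∈ X. For F ∈ W lying in the K-linear span of X, define the X-rank r_X(F) to be the least natural number r such that F lies in the K-linear span of some subset of X of cardinality r. Then rank(j(F)) ≤ k · r_X(F); equivalently, r_X(F) ≥ rank(j(F))/k. -/
/-- The `X`-rank of `F`: the least `r` such that `F` lies in the `K`-linear span of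
some subset of `X` of cardinality `r`. -/
noncomputable def Xrank {K W : Type*} [Field K] [AddCommGroup W] [Module K W]
    (X : Set W) (F : W) : ℕ :=
  sInf {r : ℕ | ∃ T : Finset W, (T : Set W) ⊆ X ∧ T.card = r ∧
    F ∈ Submodule.span K (T : Set W)}

/-- Scaling a linear map does not increase its rank. -/
theorem LinearMap.rank_smul_le_rank {K A B : Type*} [Field K] [AddCommGroup A] [Module K A]
    [AddCommGroup B] [Module K B] (c : K) (f : A →ₗ[K] B) :
    LinearMap.rank (c • f) ≤ LinearMap.rank f := by
  refine Submodule.rank_mono ?_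
  rintro _ ⟨x, rfl⟩
  exact ⟨c • x, by simp⟩

/-- **Catalecticant lower bound for `X`-rank** (Proposition 1.1 of the paper).
If `rank (j p) ≤ k` for all `p ∈ X` and `F` lies in the span of `X`, then
`rank (j F) ≤ k * r_X(F)`. -/
theorem catalecticant_bound_Xrank
    {K W A B : Type*} [Field K]
    [AddCommGroup W] [Module K W] [FiniteDimensional K W]
    [AddCommGroup A] [Module K A] [FiniteDimensional K A]
    [AddCommGroup B] [Module K B] [FiniteDimensional K B]
    (j : W →ₗ[K] (A →ₗ[K] B)) (X : Set W) (k : ℕ) (hk : 1 ≤ k)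
    (hX : ∀ p ∈ X, LinearMap.rank (j p) ≤ (k : Cardinal))
    (F : W) (hF : F ∈ Submodule.span K X) :
    LinearMap.rank (j F) ≤ ((k * Xrank (K := K) X F : ℕ) : Cardinal) := by
  obtain ⟨S, hSX, hFS⟩ := Submodule.mem_span_finite_of_mem_span hF
  obtain ⟨T, hTX, hcard, hFT⟩ :=
    Nat.sInf_mem (s := {r : ℕ | ∃ T : Finset W, (T : Set W) ⊆ X ∧ T.card = r ∧
      F ∈ Submodule.span K (T : Set W)}) ⟨S.card, S, hSX, rfl, hFS⟩
  obtain ⟨c, -, rfl⟩ := Submodule.mem_span_finset.mp hFT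
  change T.card = Xrank (K := K) X _ at hcard
  rw [← hcard, map_sum]
  calc LinearMap.rank (∑ p ∈ T, j (c p • p))
      ≤ ∑ p ∈ T, LinearMap.rank (j (c p • p)) := LinearMap.rank_finsetSum_le T _
    _ ≤ ∑ _p ∈ T, (k : Cardinal) := Finset.sum_le_sum fun p hp => by
        rw [map_smul]
        exact (LinearMap.rank_smul_le_rank _ _).trans (hX p (hTX hp))
    _ = ((k * T.card : ℕ) : Cardinal) := by
        rw [Finset.sum_const, nsmul_eq_mul, mul_comm, Nat.cast_mul]
end

section
/- Let K be a field, let W be a finite-dimensional K-vector space, and let j : W → Matrix (Fin m) (Fin n) K be a K-linear map (a matrix with entries that are linear functionals of F ∈ W). Let X ⊆ W be a subset and k a natural number such that the matrix j(p) has rank ≤ k for all p ∈ X. Then for every natural number r, every finite subset T ⊆ X with |T| ≤ r, every F in the K-linear span of T, and every pair of injections ρ : Fin (k·r+1) → Fin m and γ : Fin (k·r+1) → Fin n, the determinant of the (k·r+1)×(k·r+1) submatrix of j(F) with rows ρ and columns γ vanishes. -/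
namespace Matrix

variable {K m n : Type*} [Field K] [Fintype n]

theorem rank_add_le_rank_add_rank [Finite m] (A B : Matrix m n K) :
    (A + B).rank ≤ A.rank + B.rank := by
  rw [rank, rank, rank, mulVecLin_add]
  exact (Submodule.finrank_mono (LinearMap.range_add_le _ _)).trans
    (Submodule.finrank_add_le_finrank_add_finrank _ _)

theorem rank_smul_le_rank (c : K) (A : Matrix m n K) : (c • A).rank ≤ A.rank := by
  classical
  simpa using rank_mul_le_left A (c • (1 : Matrix n n K))

theorem rank_sum_le_sum_rank [Finite m] {ι : Type*} (s : Finset ι) (A : ι → Matrix m n K) :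
    (∑ i ∈ s, A i).rank ≤ ∑ i ∈ s, (A i).rank := by
  classical
  induction s using Finset.induction_on with
  | empty => simp
  | insert i s hi ih =>
    rw [Finset.sum_insert hi, Finset.sum_insert hi]
    exact (rank_add_le_rank_add_rank _ _).trans (Nat.add_le_add_left ih _)

theorem det_eq_zero_of_rank_lt_card [DecidableEq n] {A : Matrix n n K}
    (h : A.rank < Fintype.card n) : A.det = 0 := by
  by_contra hA
  exact h.ne (rank_of_isUnit A ((isUnit_iff_isUnit_det A).2 (isUnit_iff_ne_zero.2 hA)))

end Matrix

/-- **Minors formulation of the catalecticant bound** (Proposition 1.1 of the paper).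
If `j : W → Matrix (Fin m) (Fin n) K` is linear with `rank (j p) ≤ k` for all `p ∈ X`,
then all `(k*r+1) × (k*r+1)` minors of `j F` vanish for every `F` in the span of at most
`r` points of `X`. -/
theorem minors_vanish_on_secant
    {K W : Type*} [Field K] [AddCommGroup W] [Module K W] [FiniteDimensional K W]
    {m n : ℕ} (j : W →ₗ[K] Matrix (Fin m) (Fin n) K) (X : Set W) (k : ℕ)
    (hX : ∀ p ∈ X, (j p).rank ≤ k)
    (r : ℕ) (T : Finset W) (hTX : (T : Set W) ⊆ X) (hTr : T.card ≤ r)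
    (F : W) (hF : F ∈ Submodule.span K (T : Set W))
    (ρ : Fin (k * r + 1) → Fin m) (γ : Fin (k * r + 1) → Fin n)
    (hρ : Function.Injective ρ) (hγ : Function.Injective γ) :
    ((j F).submatrix ρ γ).det = 0 := by
  obtain ⟨c, -, rfl⟩ := Submodule.mem_span_finset.1 hF
  apply Matrix.det_eq_zero_of_rank_lt_card
  rw [Fintype.card_fin, Nat.lt_succ_iff]
  calc ((j (∑ p ∈ T, c p • p)).submatrix ρ γ).rank
      ≤ (j (∑ p ∈ T, c p • p)).rank := Matrix.rank_submatrix_le _ _ _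
    _ = (∑ p ∈ T, c p • j p).rank := by simp only [map_sum, map_smul]
    _ ≤ ∑ p ∈ T, (c p • j p).rank := Matrix.rank_sum_le_sum_rank _ _
    _ ≤ T.card • k := Finset.sum_le_card_nsmul _ _ _ fun p hp =>
        (Matrix.rank_smul_le_rank _ _).trans (hX p (hTX hp))
    _ ≤ k * r := by
        rw [smul_eq_mul, mul_comm]
        exact Nat.mul_le_mul_left k hTr
end

section
/- Let K be a field, n ≥ 1, S = K[x₀,…,x_n], and let I ⊆ S be a homogeneous ideal that is saturated with respect to the irrelevant ideal m = (x₀,…,x_n) (that is, the colon ideal I : m equals I). Suppose there exist a natural number r and t₀ such that for all t ≥ t₀ the K-dimension of S_t/(I ∩ S_t) equals r. Then for every natural number a, the K-dimension of S_a/(I ∩ S_a) is at most r. -/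
open MvPolynomial

/-- The Hilbert function of `S/I` at `t`: the `K`-dimension of `S_t/(I ∩ S_t)`. -/
noncomputable def hilbertFunction {K : Type*} [Field K] {N : ℕ}
    (I : Ideal (MvPolynomial (Fin N) K)) (t : ℕ) : ℕ :=
  Module.finrank K
    (↥(homogeneousSubmodule (Fin N) K t) ⧸
      Submodule.comap (homogeneousSubmodule (Fin N) K t).subtype
        (Submodule.restrictScalars K I))

open scoped nonZeroDivisors in
/-- If no nonzero element of `A` is annihilated by all the `x i`, then multiplication by the
generic combination `∑ i, x i * T ^ i` is injective on `A[T]` (McCoy). Hence if every `x i` maps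
`V` into `W`, the dimension of `V` is at most that of `W`. -/
theorem Submodule.finrank_le_of_mul_mem_of_forall_mul_eq_zero {K A : Type*} [Field K] [CommRing A]
    [Algebra K A] {m : ℕ} (x : Fin m → A) (hx : ∀ c, (∀ i, c * x i = 0) → c = 0)
    (V W : Submodule K A) [Module.Finite K V] [Module.Finite K W]
    (hVW : ∀ i, ∀ v ∈ V, x i * v ∈ W) : Module.finrank K V ≤ Module.finrank K W := by
  let : Algebra (Polynomial K) (Polynomial A) := Polynomial.algebra K A
  have smul_def (p : Polynomial K) (q : Polynomial A) :
      p • q = p.map (algebraMap K A) * q := Algebra.smul_def p q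
  let f : Polynomial A := ∑ i : Fin m, Polynomial.monomial (i : ℕ) (x i)
  have coeff_f (i : Fin m) : f.coeff i = x i := by
    simp [f, Polynomial.finsetSum_coeff, Polynomial.coeff_monomial, Fin.val_inj]
  have hf : f ∈ (Polynomial A)⁰ := by
    refine Polynomial.mem_nonZeroDivisors_iff.mpr fun c hc ↦ hx c fun i ↦ ?_
    simpa [coeff_f] using congr(Polynomial.coeff $hc i)
  let b := Module.finBasis K V
  let c := Module.finBasis K W
  let w : Fin (Module.finrank K W) → Polynomial A := fun k ↦ Polynomial.C (c k : A)
  have C_mem (y : A) (hy : y ∈ W) :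
      Polynomial.C y ∈ Submodule.span (Polynomial K) (Set.range w) := by
    have hy' : Polynomial.C y = ∑ k, Polynomial.C (c.repr ⟨y, hy⟩ k) • w k := by
      have hsum : y = ∑ k, algebraMap K A (c.repr ⟨y, hy⟩ k) * c k := by
        simpa [Algebra.smul_def, -Module.Basis.sum_repr] using
          congr(($(c.sum_repr ⟨y, hy⟩) : A)).symm
      simpa [smul_def, w] using congr(Polynomial.C $hsum)
    rw [hy']
    exact Submodule.sum_mem _ fun k _ ↦
      Submodule.smul_mem _ _ (Submodule.subset_span ⟨k, rfl⟩)
  let v : Fin (Module.finrank K V) → Polynomial A := fun j ↦ f * Polynomial.C (b j : A)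
  have hv : LinearIndependent (Polynomial K) v := by
    rw [Fintype.linearIndependent_iff]
    intro p hp j
    have hp' : f * ∑ j, p j • Polynomial.C (b j : A) = 0 := by
      rw [← hp, Finset.mul_sum]
      exact Finset.sum_congr rfl fun j _ ↦ mul_smul_comm _ _ _
    have hp0 := (mul_left_mem_nonZeroDivisors_eq_zero_iff hf).mp hp'
    ext d
    have hd : ∑ j, (p j).coeff d • b j = 0 := by
      apply Subtype.ext
      simpa [smul_def, Polynomial.finsetSum_coeff, Algebra.smul_def]
        using congr(Polynomial.coeff $hp0 d)
    simpa using Fintype.linearIndependent_iff.mp b.linearIndependent _ hd j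
  have hvw : Set.range v ≤ Submodule.span (Polynomial K) (Set.range w) := by
    rintro _ ⟨j, rfl⟩
    simp only [v, f, Finset.sum_mul, SetLike.mem_coe]
    refine Submodule.sum_mem _ fun i _ ↦ ?_
    have : Polynomial.monomial i (x i) * Polynomial.C (b j : A) =
        (Polynomial.X ^ (i : ℕ) : Polynomial K) • Polynomial.C (x i * b j) := by
      simp [smul_def, ← Polynomial.C_mul_X_pow_eq_monomial]
      ring
    rw [this]
    exact Submodule.smul_mem _ _ (C_mem _ (hVW i _ (b j).2))
  have : Fintype (Set.range w) := Fintype.ofFinite _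
  have hcard := linearIndependent_le_span' v hv (Set.range w) hvw
  rw [Cardinal.mk_fin, Nat.cast_le] at hcard
  exact hcard.trans ((Fintype.card_range_le w).trans_eq (Fintype.card_fin _))

theorem hilbertFunction_eq_finrank_map {K : Type*} [Field K] {N : ℕ}
    (I : Ideal (MvPolynomial (Fin N) K)) (t : ℕ) :
    hilbertFunction I t = Module.finrank K
      ((homogeneousSubmodule (Fin N) K t).map (Ideal.Quotient.mkₐ K I).toLinearMap) := by
  let g := (Ideal.Quotient.mkₐ K I).toLinearMap ∘ₗ (homogeneousSubmodule (Fin N) K t).subtype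
  have hker : Submodule.comap (homogeneousSubmodule (Fin N) K t).subtype
      (Submodule.restrictScalars K I) = LinearMap.ker g := by
    ext p
    simp [g, Ideal.Quotient.eq_zero_iff_mem]
  have hrange : LinearMap.range g =
      (homogeneousSubmodule (Fin N) K t).map (Ideal.Quotient.mkₐ K I).toLinearMap := by
    simp [g, LinearMap.range_comp]
  rw [hilbertFunction, hker, ← hrange]
  exact g.quotKerEquivRange.finrank_eq

theorem hilbertFunction_le_succ {K : Type*} [Field K] {N : ℕ}
    (I : Ideal (MvPolynomial (Fin N) K))
    (hsat : Submodule.colon I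
      (Ideal.span (Set.range (MvPolynomial.X : Fin N → MvPolynomial (Fin N) K))) = I) (t : ℕ) :
    hilbertFunction I t ≤ hilbertFunction I (t + 1) := by
  rw [hilbertFunction_eq_finrank_map, hilbertFunction_eq_finrank_map]
  have hfin (s : ℕ) : Module.Finite K (homogeneousSubmodule (Fin N) K s) :=
    Module.Finite.iff_fg.mpr (homogeneousSubmodule_fg _ _ s)
  refine Submodule.finrank_le_of_mul_mem_of_forall_mul_eq_zero
    (fun i ↦ Ideal.Quotient.mk I (X i)) (fun c hc ↦ ?_) _ _ ?_
  · obtain ⟨p, rfl⟩ := Ideal.Quotient.mk_surjective c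
    rw [Ideal.Quotient.eq_zero_iff_mem, ← hsat]
    refine Submodule.mem_colon.mpr fun s hs ↦ ?_
    induction hs using Submodule.span_induction with
    | mem y hy =>
      obtain ⟨i, rfl⟩ := hy
      simpa [← map_mul, Ideal.Quotient.eq_zero_iff_mem] using hc i
    | zero => simp
    | add y z _ _ hy hz => simpa only [smul_add] using I.add_mem hy hz
    | smul q y _ hy => simpa only [smul_comm p q y] using I.smul_mem q hy
  · rintro i _ ⟨p, hp, rfl⟩
    refine ⟨X i * p, ?_, by simp⟩
    rw [add_comm t 1]
    exact (isHomogeneous_X K i).mul hp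

/-- **Hilbert function bound for saturated ideals** (the instance for `X = ℙⁿ`,
`E = O(a)` of Proposition 2.4 of the paper). If `I` is a homogeneous ideal, saturated
with respect to the irrelevant ideal, whose Hilbert function is eventually equal to `r`,
then the Hilbert function of `S/I` is at most `r` in every degree. -/
theorem hilbert_function_le_of_saturated
    {K : Type*} [Field K] (n : ℕ) (hn : 1 ≤ n)
    (I : Ideal (MvPolynomial (Fin (n + 1)) K))
    (hhom : ∀ P ∈ I, ∀ i : ℕ, homogeneousComponent i P ∈ I)
    (hsat : Submodule.colon I
      (Ideal.span (Set.range (MvPolynomial.X : Fin (n + 1) → MvPolynomial (Fin (n + 1)) K))) = I)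
    (r t₀ : ℕ) (hconst : ∀ t ≥ t₀, hilbertFunction I t = r) :
    ∀ a : ℕ, hilbertFunction I a ≤ r := by
  exact fun a ↦ (monotone_nat_of_le_succ (hilbertFunction_le_succ I hsat) (le_max_left a t₀)).trans
    (hconst _ (le_max_right a t₀)).le
end
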